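/- arXiv:0811.3055 — 4 statements merged into one kernel-verified Lean document; each statement's English description precedes it below -/
import Mathlib

section
/- If a CSP instance φ is vertex-centered width(φ)-consistent, then φ is backtrack-free. -/
/-- A CSP instance: `m` constraints, each with a scope (a finite set of the `n`
variables) and a relation (a set of assignments, depending only on the scope). -/
structure CSPInstance (n : ℕ) (D : Type) where
  m : ℕ
  scope : Fin m → Finset (Fin n)
  rel : Fin m → Set (Fin n → D)
  rel_local : ∀ i (f g : Fin n → D), (∀ v ∈ scope i, f v = g v) → (f ∈ rel i ↔ g ∈ rel i)

/-- `φ` is backtrack-free under the ordering `π` (variables ordered `π 0 < π 1 < ...`). -/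
def BacktrackFreeUnder {n : ℕ} {D : Type} (φ : CSPInstance n D) (π : Equiv.Perm (Fin n)) : Prop :=
  ∀ i : Fin n, ∀ c : Fin n → D,
    (∀ j, φ.scope j ⊆ (Finset.Iio i).image π → c ∈ φ.rel j) →
    ∃ v : D, ∀ j, φ.scope j ⊆ (Finset.Iic i).image π → Function.update c (π i) v ∈ φ.rel j

/-- `φ` is backtrack-free if it is backtrack-free under some ordering. -/
def BacktrackFree {n : ℕ} {D : Type} (φ : CSPInstance n D) : Prop :=
  ∃ π, BacktrackFreeUnder φ π

/-- The width of the ordering `π`: the maximum over variables `π i` of the number of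
constraints whose scope contains `π i` and is contained in `{π 0, ..., π i}`. -/
def widthOrd {n : ℕ} {D : Type} (φ : CSPInstance n D) (π : Equiv.Perm (Fin n)) : ℕ :=
  Finset.univ.sup (fun i : Fin n =>
    (Finset.univ.filter
      (fun j : Fin φ.m => π i ∈ φ.scope j ∧ φ.scope j ⊆ (Finset.Iic i).image π)).card)

/-- The width of `φ`: the minimum width over all orderings. -/
noncomputable def width {n : ℕ} {D : Type} (φ : CSPInstance n D) : ℕ :=
  sInf (Set.range (widthOrd φ))

/-- `φ` is vertex-centered `t`-consistent: for every variable `u` and every set `Cu` of at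
most `t` constraints all of whose scopes contain `u`, every partial assignment on the set
`N` of other variables occurring in scopes of `Cu` that is compatible with all constraints
with scope inside `N` can be extended at `u` compatibly with all constraints of `Cu`. -/
def VCConsistent {n : ℕ} {D : Type} (φ : CSPInstance n D) (t : ℕ) : Prop :=
  ∀ u : Fin n, ∀ Cu : Finset (Fin φ.m),
    (∀ j ∈ Cu, u ∈ φ.scope j) → Cu.card ≤ t →
    ∀ c : Fin n → D,
      (∀ j : Fin φ.m, φ.scope j ⊆ (Cu.biUnion φ.scope).erase u → c ∈ φ.rel j) →
      ∃ v : D, ∀ j ∈ Cu, Function.update c u v ∈ φ.rel j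

/-- If a CSP instance `φ` is vertex-centered `width φ`-consistent, then `φ` is
backtrack-free. -/
theorem backtrackFree_of_vcConsistent_width {n : ℕ} {D : Type} (φ : CSPInstance n D)
    (h : VCConsistent φ (width φ)) : BacktrackFree φ := by
  obtain ⟨π, hπ⟩ : width φ ∈ Set.range (widthOrd φ) := Nat.sInf_mem (Set.range_nonempty _)
  refine ⟨π, fun i c hc => ?_⟩
  have mem_Iio : ∀ x ∈ (Finset.Iic i).image π, x ≠ π i → x ∈ (Finset.Iio i).image π := by
    intro x hx hne
    obtain ⟨k, hk, rfl⟩ := Finset.mem_image.1 hx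
    exact Finset.mem_image_of_mem π (Finset.mem_Iio.2
      (lt_of_le_of_ne (Finset.mem_Iic.1 hk) fun hki => hne (hki ▸ rfl)))
  obtain ⟨v, hv⟩ := h (π i)
    (Finset.univ.filter fun j => π i ∈ φ.scope j ∧ φ.scope j ⊆ (Finset.Iic i).image π)
    (fun j hj => (Finset.mem_filter.1 hj).2.1)
    (hπ ▸ Finset.le_sup (f := fun i : Fin n => (Finset.univ.filter fun j : Fin φ.m =>
      π i ∈ φ.scope j ∧ φ.scope j ⊆ (Finset.Iic i).image π).card) (Finset.mem_univ i)) c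
    (fun j hj => hc j fun x hx => by
      obtain ⟨hne, hx⟩ := Finset.mem_erase.1 (hj hx)
      obtain ⟨k, hk, hxk⟩ := Finset.mem_biUnion.1 hx
      exact mem_Iio x ((Finset.mem_filter.1 hk).2.2 hxk) hne)
  refine ⟨v, fun j hj => ?_⟩
  by_cases hmem : π i ∈ φ.scope j
  · exact hv j (Finset.mem_filter.2 ⟨Finset.mem_univ j, hmem, hj⟩)
  · have hne : ∀ x ∈ φ.scope j, x ≠ π i := fun x hx hxi => hmem (hxi ▸ hx)
    exact (φ.rel_local j _ c fun x hx => Function.update_of_ne (hne x hx) _ _).2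
      (hc j fun x hx => mem_Iio x (hj hx) (hne x hx))
end

section
/- If a CSP instance φ is vertex-centered t-consistent and π is a linear ordering of its variables with width(π) ≤ t, then φ is backtrack-free under π. -/
/-- If a CSP instance `φ` is vertex-centered `t`-consistent and `π` is an ordering of its
variables with `widthOrd φ π ≤ t`, then `φ` is backtrack-free under `π`. -/
theorem backtrackFreeUnder_of_vcConsistent {n : ℕ} {D : Type} (φ : CSPInstance n D)
    (t : ℕ) (π : Equiv.Perm (Fin n)) (h : VCConsistent φ t) (hw : widthOrd φ π ≤ t) :
    BacktrackFreeUnder φ π := by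
  intro i c hc
  obtain ⟨v, hv⟩ := h (π i)
    (Finset.univ.filter fun j => π i ∈ φ.scope j ∧ φ.scope j ⊆ (Finset.Iic i).image π)
    (fun j hj => (Finset.mem_filter.1 hj).2.1)
    ((Finset.le_sup (f := fun i : Fin n => (Finset.univ.filter
      (fun j : Fin φ.m => π i ∈ φ.scope j ∧ φ.scope j ⊆ (Finset.Iic i).image π)).card)
      (Finset.mem_univ i)).trans hw) c
    (fun j hj => hc j fun x hx => by
      obtain ⟨hne, hx⟩ := Finset.mem_erase.1 (hj hx)
      obtain ⟨k, hk, hxk⟩ := Finset.mem_biUnion.1 hx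
      obtain ⟨a, ha, rfl⟩ := Finset.mem_image.1 ((Finset.mem_filter.1 hk).2.2 hxk)
      exact Finset.mem_image_of_mem π (Finset.mem_Iio.2
        (lt_of_le_of_ne (Finset.mem_Iic.1 ha) fun hai => hne (congrArg π hai))))
  refine ⟨v, fun j hj => ?_⟩
  by_cases hi : π i ∈ φ.scope j
  · exact hv j (Finset.mem_filter.2 ⟨Finset.mem_univ j, hi, hj⟩)
  · have hne : ∀ x ∈ φ.scope j, x ≠ π i := fun x hx hxi => hi (hxi ▸ hx)
    refine (φ.rel_local j _ c fun x hx => Function.update_of_ne (hne x hx) v c).2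
      (hc j fun x hx => ?_)
    obtain ⟨a, ha, rfl⟩ := Finset.mem_image.1 (hj hx)
    exact Finset.mem_image_of_mem π (Finset.mem_Iio.2
      (lt_of_le_of_ne (Finset.mem_Iic.1 ha) fun hai => hne _ hx (congrArg π hai)))
end

section
/- Let k ≥ 2 be an integer and r > 0, 0 < ε < 1 constants. With high probability, the width of the random hypergraph HG(n, ⌈r n ln n⌉, k) is at most (1 + ε) k r ln n. -/
/-- Sample space for the random `k`-uniform multihypergraph `HG(n,m,k)`: each of the `m`
hyperedges is a `k`-element subset of `[n]`, chosen independently and uniformly. -/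
abbrev HGOmega (n m k : ℕ) := Fin m → {S : Finset (Fin n) // S.card = k}

/-- The probability of an event under the uniform distribution on `HGOmega n m k`. -/
noncomputable def hgPr (n m k : ℕ) (E : HGOmega n m k → Prop) : ℝ :=
  haveI : DecidablePred E := Classical.decPred E
  ((Finset.univ.filter E).card : ℝ) / (Fintype.card (HGOmega n m k) : ℝ)

/-- The width of a vertex ordering `π` of a finite multihypergraph on vertex set `Fin n`
with hyperedges `edges j`: the maximum over vertices `π i` of the number of hyperedges
containing `π i` all of whose vertices lie in `{π 0, ..., π i}`. -/
def hgWidthOrd {n m : ℕ} (edges : Fin m → Finset (Fin n)) (π : Equiv.Perm (Fin n)) : ℕ :=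
  Finset.univ.sup (fun i : Fin n =>
    (Finset.univ.filter
      (fun j : Fin m => π i ∈ edges j ∧ edges j ⊆ (Finset.Iic i).image π)).card)

/-- The width of a finite multihypergraph: the minimum width over all vertex orderings. -/
noncomputable def hgWidth {n m : ℕ} (edges : Fin m → Finset (Fin n)) : ℕ :=
  sInf (Set.range (hgWidthOrd edges))

open Finset in
/-- Weighted exponential-moment bound: among `m` independent uniform samples from `α`, the number
landing in a set of density at most `p` exceeds `t` with probability at most
`exp (m p (exp l - 1) - l t)`. -/
lemma card_filter_lt_card_le_exp {α : Type*} [Fintype α] [Nonempty α] (P : α → Prop)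
    [DecidablePred P] (m : ℕ) (p l t : ℝ) (hl : 0 ≤ l)
    (hp : (#{a | P a} : ℝ) ≤ p * Fintype.card α) :
    (#{ω : Fin m → α | t < (#{j | P (ω j)} : ℝ)} : ℝ) ≤
      (Fintype.card α : ℝ) ^ m * Real.exp (m * p * (Real.exp l - 1) - l * t) := by
  have hcard : (0 : ℝ) < Fintype.card α := by exact_mod_cast Fintype.card_pos
  have hexp : 0 ≤ Real.exp l - 1 := by linarith [Real.add_one_le_exp l]
  have hmoment : (#{ω : Fin m → α | t < (#{j | P (ω j)} : ℝ)} : ℝ) * Real.exp (l * t) ≤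
      (∑ a : α, if P a then Real.exp l else 1) ^ m := by
    rw [Fintype.sum_pow, ← nsmul_eq_mul, ← sum_const]
    refine (sum_le_sum fun ω hω => ?_).trans
      (sum_le_sum_of_subset_of_nonneg (filter_subset _ _) fun ω _ _ => ?_)
    · rw [mem_filter] at hω
      rw [prod_ite, prod_const, prod_const_one, mul_one, ← Real.exp_nat_mul]
      refine Real.exp_le_exp.mpr ?_
      nlinarith [hω.2]
    · exact prod_nonneg fun j _ => by split_ifs <;> positivity
  have hsum : (∑ a : α, if P a then Real.exp l else 1) ≤
      Fintype.card α * Real.exp (p * (Real.exp l - 1)) := by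
    have h1 : (∑ a : α, if P a then Real.exp l else 1) =
        #{a | P a} * (Real.exp l - 1) + Fintype.card α := by
      have : ∀ a : α, (if P a then Real.exp l else 1) =
          (if P a then (Real.exp l - 1) else 0) + 1 := fun a => by split_ifs <;> ring
      simp_rw [this, sum_add_distrib, ← sum_filter, sum_const]
      simp
    rw [h1]
    nlinarith [mul_le_mul_of_nonneg_right hp hexp, Real.add_one_le_exp (p * (Real.exp l - 1))]
  have hnn : 0 ≤ ∑ a : α, if P a then Real.exp l else 1 :=
    sum_nonneg fun a _ => by split_ifs <;> positivity
  rw [Real.exp_sub, mul_div_assoc', le_div_iff₀ (Real.exp_pos _)]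
  refine hmoment.trans ((pow_le_pow_left₀ hnn hsum m).trans_eq ?_)
  rw [mul_pow, ← Real.exp_nat_mul]
  ring_nf

lemma choose_mul_pow_le {u n : ℕ} (h : u ≤ n) (k : ℕ) :
    u.choose k * n ^ k ≤ n.choose k * u ^ k := by
  induction k with
  | zero => simp
  | succ k ih =>
    refine Nat.le_of_mul_le_mul_right ?_ k.succ_pos
    have h1 : (u - k) * n ≤ (n - k) * u := by
      rw [Nat.sub_mul, Nat.sub_mul, mul_comm n u]
      exact Nat.sub_le_sub_left (Nat.mul_le_mul_left k h) _
    calc u.choose (k + 1) * n ^ (k + 1) * (k + 1)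
        = (u.choose (k + 1) * (k + 1)) * n ^ (k + 1) := by ring
      _ = (u.choose k * n ^ k) * ((u - k) * n) := by
        rw [Nat.choose_succ_right_eq]; ring
      _ ≤ (n.choose k * u ^ k) * ((n - k) * u) := Nat.mul_le_mul ih h1
      _ = (n.choose (k + 1) * (k + 1)) * u ^ (k + 1) := by
        rw [Nat.choose_succ_right_eq]; ring
      _ = n.choose (k + 1) * u ^ (k + 1) * (k + 1) := by ring

open Finset in
lemma card_subtype_subset_le {n k : ℕ} (hk : 2 ≤ k) (hn : 0 < n) (U : Finset (Fin n)) :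
    (#{S : {S : Finset (Fin n) // S.card = k} | S.1 ⊆ U} : ℝ) ≤
      ((#U : ℝ) / n) ^ 2 * Fintype.card {S : Finset (Fin n) // S.card = k} := by
  have hle : #U ≤ n := by simpa using card_le_univ U
  have hcard : Fintype.card {S : Finset (Fin n) // S.card = k} = n.choose k := by simp
  have hsub : #{S : {S : Finset (Fin n) // S.card = k} | S.1 ⊆ U} = (#U).choose k := by
    rw [← card_powersetCard, ← card_map (Function.Embedding.subtype _)]
    congr 1
    ext S
    simp [mem_powersetCard, and_comm]
  rw [hcard, hsub]
  have hn' : (0 : ℝ) < n := by exact_mod_cast hn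
  have hx1 : (#U : ℝ) / n ≤ 1 := (div_le_one hn').mpr (by exact_mod_cast hle)
  have hx : ((#U : ℝ) / n) ^ k ≤ ((#U : ℝ) / n) ^ 2 :=
    pow_le_pow_of_le_one (by positivity) hx1 hk
  refine le_trans ?_ (mul_le_mul_of_nonneg_right hx (Nat.cast_nonneg _))
  rw [div_pow, div_mul_eq_mul_div, le_div_iff₀ (by positivity), mul_comm ((#U : ℝ) ^ k)]
  exact_mod_cast choose_mul_pow_le hle k

open Finset in
/-- A vertex set spanning few edges contains a vertex of small degree within the set. -/
lemma exists_mem_card_filter_le {n m k d : ℕ} (edges : Fin m → Finset (Fin n))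
    (hedge : ∀ j, #(edges j) = k) (U : Finset (Fin n))
    (hU : #{j | edges j ⊆ U} * k < (d + 1) * #U) :
    ∃ v ∈ U, #{j | v ∈ edges j ∧ edges j ⊆ U} ≤ d := by
  by_contra! hcon
  have hle : (d + 1) * #U ≤ ∑ v ∈ U, #{j | v ∈ edges j ∧ edges j ⊆ U} := by
    rw [mul_comm, ← smul_eq_mul]
    exact card_nsmul_le_sum _ _ _ fun v hv => hcon v hv
  have heq : ∑ v ∈ U, #{j | v ∈ edges j ∧ edges j ⊆ U} = #{j | edges j ⊆ U} * k := by
    have h1 : ∀ v, #{j | v ∈ edges j ∧ edges j ⊆ U} =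
        ∑ j ∈ ({j | edges j ⊆ U} : Finset (Fin m)), if v ∈ edges j then 1 else 0 := fun v => by
      rw [← card_filter, filter_filter]
      simp_rw [and_comm]
    simp_rw [h1]
    rw [sum_comm, ← smul_eq_mul, ← sum_const]
    refine sum_congr rfl fun j hj => ?_
    rw [← card_filter, filter_mem_eq_inter, inter_eq_right.mpr (mem_filter.mp hj).2, hedge j]
  omega

open Finset in
/-- If every nonempty vertex set contains a vertex of degree at most `d` within that set, then
the width is at most `d`. -/
lemma hgWidth_le_of_forall_exists {n m d : ℕ} (edges : Fin m → Finset (Fin n))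
    (h : ∀ U : Finset (Fin n), U.Nonempty → ∃ v ∈ U, #{j | v ∈ edges j ∧ edges j ⊆ U} ≤ d) :
    hgWidth edges ≤ d := by
  have hperm : ∀ s ≤ n, ∃ π : Equiv.Perm (Fin n), ∀ i : Fin n, n ≤ i + s →
      #{j | π i ∈ edges j ∧ edges j ⊆ (Iic i).image π} ≤ d := by
    intro s
    induction s with
    | zero => exact fun _ => ⟨1, fun i hi => absurd i.2 (by omega)⟩
    | succ s ih =>
      intro hs
      obtain ⟨π, hπ⟩ := ih (by omega)
      let a : Fin n := ⟨n - (s + 1), by omega⟩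
      have ha : (a : ℕ) = n - (s + 1) := rfl
      obtain ⟨v, hv, hdeg⟩ := h ((Iic a).image π) ⟨π a, mem_image_of_mem _ (by simp)⟩
      obtain ⟨b, hb, rfl⟩ := mem_image.mp hv
      have hba : b ≤ a := by simpa using hb
      have hIic : ∀ i, a ≤ i → (Iic i).image ⇑(π * Equiv.swap a b) = (Iic i).image π := by
        intro i hai
        have hswap : (Iic i).image (Equiv.swap a b) = Iic i := by
          refine eq_of_subset_of_card_le (fun x hx => ?_)
            (card_image_of_injective _ (Equiv.injective _)).ge
          obtain ⟨y, hy, rfl⟩ := mem_image.mp hx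
          rw [mem_Iic] at hy ⊢
          rw [Equiv.swap_apply_def]
          split_ifs
          exacts [hba.trans hai, hai, hy]
        rw [Equiv.Perm.coe_mul, ← image_image, hswap]
      refine ⟨π * Equiv.swap a b, fun i hi => ?_⟩
      have hai : a ≤ i := by rw [Fin.le_def]; omega
      rw [hIic i hai]
      rcases hai.eq_or_lt with rfl | hlt
      · simpa using hdeg
      · rw [Equiv.Perm.mul_apply,
          Equiv.swap_apply_of_ne_of_ne hlt.ne' (hba.trans_lt hlt).ne']
        exact hπ i (by rw [Fin.lt_def] at hlt; omega)
  obtain ⟨π, hπ⟩ := hperm n le_rfl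
  exact (Nat.sInf_le (Set.mem_range_self π)).trans (Finset.sup_le fun i _ => hπ i (by omega))

open Finset in
lemma hgWidth_le_of_forall_card_le {n m k : ℕ} (hk : 0 < k) (edges : Fin m → Finset (Fin n))
    (hedge : ∀ j, #(edges j) = k) (D : ℝ) (hD : 0 ≤ D)
    (h : ∀ U : Finset (Fin n), U.Nonempty → (#{j | edges j ⊆ U} : ℝ) ≤ D * #U) :
    (hgWidth edges : ℝ) ≤ k * D := by
  refine le_trans ?_ (Nat.floor_le (a := k * D) (by positivity))
  refine Nat.cast_le.mpr (hgWidth_le_of_forall_exists edges fun U hU =>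
    exists_mem_card_filter_le edges hedge U ?_)
  have hpos : (0 : ℝ) < #U := by exact_mod_cast hU.card_pos
  have hk' : (0 : ℝ) < k := by exact_mod_cast hk
  have hreal : (#{j | edges j ⊆ U} : ℝ) * k < (⌊k * D⌋₊ + 1) * #U := by
    nlinarith [h U hU, Nat.lt_floor_add_one ((k : ℝ) * D),
      mul_le_mul_of_nonneg_right (h U hU) hk'.le,
      mul_lt_mul_of_pos_right (Nat.lt_floor_add_one ((k : ℝ) * D)) hpos]
  exact_mod_cast hreal

open Finset in
/-- Union bound for the failure of the edge-density condition over all nonempty vertex sets. -/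
lemma one_sub_sum_le_hgPr {n m k : ℕ} (hk : 0 < k) (hkn : k ≤ n) (D : ℝ) (hD : 0 ≤ D)
    (f : Finset (Fin n) → ℝ)
    (hf : ∀ U : Finset (Fin n), U.Nonempty →
      (#{ω : HGOmega n m k | D * #U < (#{j | (ω j).1 ⊆ U} : ℝ)} : ℝ) ≤
        Fintype.card (HGOmega n m k) * f U) :
    1 - ∑ U ∈ univ.erase ∅, f U ≤
      hgPr n m k (fun ω => (hgWidth (fun j => (ω j).1) : ℝ) ≤ k * D) := by
  classical
  have : Nonempty {S : Finset (Fin n) // S.card = k} := by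
    obtain ⟨S, -, hS⟩ := exists_subset_card_eq (s := (univ : Finset (Fin n))) (n := k) (by simpa)
    exact ⟨⟨S, hS⟩⟩
  have hcard : (0 : ℝ) < Fintype.card (HGOmega n m k) := by exact_mod_cast Fintype.card_pos
  unfold hgPr
  rw [le_div_iff₀ hcard]
  set E : HGOmega n m k → Prop := fun ω => (hgWidth (fun j => (ω j).1) : ℝ) ≤ k * D with hE
  have hsub : (univ.filter fun ω => ¬ E ω) ⊆ (univ.erase ∅).biUnion
      fun U => ({ω : HGOmega n m k | D * #U < (#{j | (ω j).1 ⊆ U} : ℝ)} : Finset _) := by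
    intro ω hω
    rw [mem_filter] at hω
    by_contra hnot
    refine hω.2 (hgWidth_le_of_forall_card_le hk _ (fun j => (ω j).2) D hD fun U hU => ?_)
    by_contra! hlt
    exact hnot (mem_biUnion.mpr ⟨U, by simpa using hU.ne_empty, by simpa using hlt⟩)
  have hbad : (#{ω | ¬ E ω} : ℝ) ≤ Fintype.card (HGOmega n m k) * ∑ U ∈ univ.erase ∅, f U := by
    have h1 : (#{ω | ¬ E ω} : ℝ) ≤ ∑ U ∈ univ.erase (∅ : Finset (Fin n)),
        (#{ω : HGOmega n m k | D * #U < (#{j | (ω j).1 ⊆ U} : ℝ)} : ℝ) := by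
      exact_mod_cast (card_le_card hsub).trans card_biUnion_le
    refine h1.trans ?_
    rw [mul_sum]
    exact sum_le_sum fun U hU => hf U (nonempty_iff_ne_empty.mpr (ne_of_mem_erase hU))
  have hsplit : (#{ω | E ω} : ℝ) + #{ω | ¬ E ω} = Fintype.card (HGOmega n m k) := by
    exact_mod_cast card_filter_add_card_filter_not (s := univ) E
  have hconv : (#{ω | E ω} : ℝ) =
      ((@Finset.filter _ E (Classical.decPred E) univ).card : ℝ) := by
    congr!
  rw [← hconv]
  linarith

lemma hgPr_le_one (n m k : ℕ) (E : HGOmega n m k → Prop) : hgPr n m k E ≤ 1 :=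
  div_le_one_of_le₀ (by exact_mod_cast Finset.card_le_univ _) (Nat.cast_nonneg _)

/-- The two choices of the exponential tilt, for small and for large vertex sets (`x = u / n`). -/
lemma exists_tilt_exponent_le {r ε K n L u m : ℝ} (hr : 0 < r) (hε0 : 0 < ε) (hε1 : ε < 1)
    (hK : K = 2 + 2 / r) (hn : 0 < n) (hL : 0 < L) (hu : 0 < u) (hun : u ≤ n)
    (hm0 : 0 ≤ m) (hm : m ≤ (1 + ε / 4) * (r * n * L)) :
    ∃ l : ℝ, 0 ≤ l ∧ (m * (u / n) ^ 2 * (Real.exp l - 1) - l * ((1 + ε) * r * L * u) ≤ -2 * L * u ∨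
      m * (u / n) ^ 2 * (Real.exp l - 1) - l * ((1 + ε) * r * L * u) ≤
        -(r * ε ^ 2 * Real.exp (-K) / 16) * n * L) := by
  have hx0 : 0 < u / n := by positivity
  have hx1 : u / n ≤ 1 := (div_le_one hn).mpr hun
  have hmx : m * (u / n) ≤ (1 + ε / 4) * (r * L * u) := by
    refine (mul_le_mul_of_nonneg_right hm hx0.le).trans_eq ?_
    field_simp
  have hrLu : 0 < r * L * u := by positivity
  rcases le_total (u / n) (Real.exp (-K)) with hx | hx
  · have hK0 : 0 < K := by rw [hK]; positivity
    refine ⟨K, hK0.le, Or.inl ?_⟩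
    have h1 : (u / n) * (Real.exp K - 1) ≤ 1 := by
      have := mul_le_mul_of_nonneg_right hx (Real.exp_pos K).le
      rw [← Real.exp_add, neg_add_cancel, Real.exp_zero] at this
      linarith
    have h2 : m * (u / n) ^ 2 * (Real.exp K - 1) ≤ m * (u / n) := by
      have := mul_le_mul_of_nonneg_left h1 (mul_nonneg hm0 hx0.le)
      linarith [show m * (u / n) ^ 2 * (Real.exp K - 1) =
        m * (u / n) * ((u / n) * (Real.exp K - 1)) by ring]
    have h3 : K * (r * L * u) = 2 * (r * L * u) + 2 * L * u := by
      rw [hK]; field_simp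
    nlinarith [mul_pos (mul_pos hK0 hε0) hrLu]
  · refine ⟨ε / 4, by positivity, Or.inr ?_⟩
    have h1 : Real.exp (ε / 4) - 1 ≤ ε / 4 * (1 + ε / 4) := by
      have := Real.abs_exp_sub_one_sub_id_le (x := ε / 4)
        (by rw [abs_of_pos (by positivity)]; linarith)
      linarith [(abs_le.mp this).2]
    have h0 : 0 ≤ Real.exp (ε / 4) - 1 := by linarith [Real.add_one_le_exp (ε / 4)]
    have h2 : m * (u / n) ^ 2 ≤ m * (u / n) := by
      rw [sq]
      exact mul_le_mul_of_nonneg_left (mul_le_of_le_one_left hx0.le hx1) hm0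
    have h3 : m * (u / n) ^ 2 * (Real.exp (ε / 4) - 1) ≤
        (1 + ε / 4) * (r * L * u) * (ε / 4 * (1 + ε / 4)) :=
      mul_le_mul (h2.trans hmx) h1 h0 (by positivity)
    have h4 : Real.exp (-K) * n ≤ u := (le_div_iff₀ hn).mp hx
    have h5 : r * ε ^ 2 / 16 * L * (Real.exp (-K) * n) ≤ r * ε ^ 2 / 16 * L * u :=
      mul_le_mul_of_nonneg_left h4 (by positivity)
    have h6 : (1 + ε / 4) * (r * L * u) * (ε / 4 * (1 + ε / 4)) -
        ε / 4 * ((1 + ε) * r * L * u) ≤ -(r * ε ^ 2 / 16 * L * u) := by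
      have : 0 ≤ (r * L * u) * (ε ^ 2 * (1 - ε)) := by
        have : 0 ≤ 1 - ε := by linarith
        positivity
      nlinarith [mul_pos hrLu (pow_pos hε0 2)]
    nlinarith

open Finset in
lemma sum_erase_exp_le {n : ℕ} (L c : ℝ) :
    ∑ U ∈ (univ : Finset (Finset (Fin n))).erase ∅,
      (Real.exp (-2 * L * #U) + Real.exp (-c * n * L)) ≤
      Real.exp (n * Real.exp (-2 * L)) - 1 + Real.exp (n * (1 - c * L)) := by
  rw [sum_add_distrib]
  refine add_le_add ?_ ?_
  · rw [le_sub_iff_add_le]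
    have h1 : ∑ U : Finset (Fin n), Real.exp (-2 * L * #U) = (Real.exp (-2 * L) + 1) ^ n := by
      have := Fintype.sum_pow_mul_eq_add_pow (Fin n) (Real.exp (-2 * L)) 1
      simp only [one_pow, mul_one, Fintype.card_fin] at this
      rw [← this]
      refine sum_congr rfl fun U _ => ?_
      rw [← Real.exp_nat_mul]
      ring_nf
    rw [← sum_erase_add _ _ (mem_univ ∅)] at h1
    simp only [card_empty, Nat.cast_zero, mul_zero, Real.exp_zero] at h1
    rw [h1, Real.exp_nat_mul]
    exact pow_le_pow_left₀ (by positivity) (Real.add_one_le_exp _) n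
  · rw [sum_const, nsmul_eq_mul]
    have h2 : (#((univ : Finset (Finset (Fin n))).erase ∅) : ℝ) ≤ Real.exp n := by
      have h3 : (#((univ : Finset (Finset (Fin n))).erase ∅) : ℝ) ≤ 2 ^ n := by
        exact_mod_cast (card_erase_le).trans_eq (by simp)
      refine h3.trans ?_
      rw [← mul_one (n : ℝ), Real.exp_nat_mul]
      exact pow_le_pow_left₀ (by norm_num) (by linarith [Real.add_one_le_exp 1]) n
    refine (mul_le_mul_of_nonneg_right h2 (Real.exp_pos _).le).trans_eq ?_
    rw [← Real.exp_add]
    ring_nf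

open Filter Topology in
lemma tendsto_log_natCast_atTop :
    Tendsto (fun n : ℕ => Real.log n) atTop atTop :=
  Real.tendsto_log_atTop.comp tendsto_natCast_atTop_atTop

open Filter Topology in
lemma tendsto_failure_bound {c : ℝ} (hc : 0 < c) :
    Tendsto (fun n : ℕ => Real.exp (n * Real.exp (-2 * Real.log n)) - 1 +
      Real.exp (n * (1 - c * Real.log n))) atTop (𝓝 0) := by
  have h1 : Tendsto (fun n : ℕ => (n : ℝ) * Real.exp (-2 * Real.log n)) atTop (𝓝 0) := by
    refine tendsto_inv_atTop_nhds_zero_nat.congr' ?_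
    filter_upwards [eventually_gt_atTop 0] with n hn
    have hn' : (0 : ℝ) < n := by exact_mod_cast hn
    rw [show -2 * Real.log n = -(Real.log n + Real.log n) by ring, Real.exp_neg, Real.exp_add,
      Real.exp_log hn']
    field_simp
  have h2 : Tendsto (fun n : ℕ => (n : ℝ) * (1 - c * Real.log n)) atTop atBot :=
    tendsto_natCast_atTop_atTop.atTop_mul_atBot₀
      (tendsto_atBot_add_const_left _ 1
        (tendsto_neg_atTop_atBot.comp (tendsto_log_natCast_atTop.const_mul_atTop hc)))
  have h3 := ((Real.continuous_exp.tendsto 0).comp h1).sub_const 1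
  simpa using h3.add (Real.tendsto_exp_atBot.comp h2)

/-- For `k ≥ 2`, `r > 0` and `0 < ε < 1`, with high probability the width of
`HG(n, ⌈r n ln n⌉, k)` is at most `(1 + ε) k r ln n`. -/
theorem hg_width_upper (k : ℕ) (hk : 2 ≤ k) (r ε : ℝ) (hr : 0 < r) (hε0 : 0 < ε)
    (hε1 : ε < 1) :
    Filter.Tendsto
      (fun n : ℕ => hgPr n ⌈r * n * Real.log n⌉₊ k
        (fun ω => (hgWidth (fun j => (ω j).1) : ℝ) ≤ (1 + ε) * k * r * Real.log n))
      Filter.atTop (nhds 1) := by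
  obtain ⟨K, hK⟩ : ∃ K, K = 2 + 2 / r := ⟨_, rfl⟩
  have hc : 0 < r * ε ^ 2 * Real.exp (-K) / 16 := by positivity
  have hlower := (tendsto_failure_bound hc).const_sub 1
  rw [sub_zero] at hlower
  refine tendsto_of_tendsto_of_tendsto_of_le_of_le' hlower tendsto_const_nhds ?_
    (Filter.Eventually.of_forall fun n => hgPr_le_one _ _ _ _)
  filter_upwards [Filter.eventually_ge_atTop k,
    tendsto_log_natCast_atTop.eventually_ge_atTop 1,
    tendsto_natCast_atTop_atTop.eventually_ge_atTop (4 / (ε * r))] with n hkn hlog hnr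
  have hn : 0 < n := by omega
  have hn' : (0 : ℝ) < n := by exact_mod_cast hn
  have hL : 0 < Real.log n := by linarith
  set m := ⌈r * n * Real.log n⌉₊
  have hm : (m : ℝ) ≤ (1 + ε / 4) * (r * n * Real.log n) := by
    have h1 : (m : ℝ) < r * n * Real.log n + 1 := Nat.ceil_lt_add_one (by positivity)
    have h2 : 4 ≤ n * (ε * r) := (div_le_iff₀ (by positivity)).mp hnr
    have h3 : n * (ε * r) * 1 ≤ n * (ε * r) * Real.log n :=
      mul_le_mul_of_nonneg_left hlog (by positivity)
    nlinarith
  have : Nonempty {S : Finset (Fin n) // S.card = k} := by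
    obtain ⟨S, -, hS⟩ :=
      Finset.exists_subset_card_eq (s := (Finset.univ : Finset (Fin n))) (n := k) (by simpa)
    exact ⟨⟨S, hS⟩⟩
  have hunion := one_sub_sum_le_hgPr (m := m) (k := k) (by omega) hkn
    ((1 + ε) * r * Real.log n) (by positivity)
    (fun U => Real.exp (-2 * Real.log n * U.card) +
      Real.exp (-(r * ε ^ 2 * Real.exp (-K) / 16) * n * Real.log n)) (fun U hU => by
      have hu : (0 : ℝ) < U.card := by exact_mod_cast hU.card_pos
      have hun : (U.card : ℝ) ≤ n := by exact_mod_cast (by simpa using Finset.card_le_univ U)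
      obtain ⟨l, hl, hexp⟩ := exists_tilt_exponent_le hr hε0 hε1 hK hn' hL hu hun
        (Nat.cast_nonneg m) hm
      refine (card_filter_lt_card_le_exp (fun S : {S : Finset (Fin n) // S.card = k} => S.1 ⊆ U)
        m _ l _ hl (card_subtype_subset_le hk hn U)).trans ?_
      rw [Fintype.card_fun, Fintype.card_fin, Nat.cast_pow]
      refine mul_le_mul_of_nonneg_left ?_ (by positivity)
      rcases hexp with hexp | hexp
      · exact (Real.exp_le_exp.mpr hexp).trans (le_add_of_nonneg_right (Real.exp_pos _).le)
      · exact (Real.exp_le_exp.mpr hexp).trans (le_add_of_nonneg_left (Real.exp_pos _).le))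
  rw [show (1 + ε) * k * r * Real.log n = k * ((1 + ε) * r * Real.log n) by ring]
  exact (sub_le_sub_left (sum_erase_exp_le _ _) 1).trans hunion
end

section
/- Let α > 0, p ∈ (0,1), integer k ≥ 2 be constants, let r_bf = −α/(k ln(1−p)), and suppose r < r_bf and 0 < ε < min((r_bf − r)/r, 1/2). Set t = (1+ε) k r ln n. Then there exists γ > 0 such that for all sufficiently large n, a random instance of Model RD is vertex-centered t-consistent (every variable is vertex-centered t-consistent) with probability at least 1 − e^{−n^γ}. -/
/-- Sample space for a random instance of Model RD with `n` variables, domain `Fin d`,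
`m` constraints, each constraint scope a `k`-element set of variables: the first component
gives the scopes, the second gives, for each constraint, a boolean flag for every partial
assignment (the flags indexed by partial assignments supported exactly on the scope
determine which scope-assignments are compatible). -/
abbrev RDOmega (n d m k : ℕ) :=
  (Fin m → {S : Finset (Fin n) // S.card = k}) × (Fin m → (Fin n → Option (Fin d)) → Bool)

/-- The probability weight of an outcome: scopes are uniform among `k`-element subsets,
and each flag is `true` independently with probability `1 - p`. -/
noncomputable def rdWeight (p : ℝ) {n d m k : ℕ} (ω : RDOmega n d m k) : ℝ :=
  ((Fintype.card {S : Finset (Fin n) // S.card = k} : ℝ))⁻¹ ^ m *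
    ∏ i : Fin m, ∏ g : Fin n → Option (Fin d), (if ω.2 i g then 1 - p else p)

/-- The probability of an event for Model RD. -/
noncomputable def rdPr (p : ℝ) (n d m k : ℕ) (E : RDOmega n d m k → Prop) : ℝ :=
  haveI : DecidablePred E := Classical.decPred E
  ∑ ω ∈ Finset.univ.filter E, rdWeight p ω

/-- The (total) assignment `c` is compatible with constraint `i`: the flag of the
restriction of `c` to the scope of `i` is `true`. Since only the restriction of `c` to
the scope is consulted, this expresses compatibility of any partial assignment defined on
a superset of the scope. -/
def rdCompat {n d m k : ℕ} (ω : RDOmega n d m k) (i : Fin m) (c : Fin n → Fin d) : Prop :=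
  ω.2 i (fun v => if v ∈ (ω.1 i).1 then some (c v) else none) = true

/-- A sum over all Boolean flag tables of a product over the entries factors. -/
lemma sum_prod_prod_flags {ι κ : Type*} [Fintype ι] [Fintype κ] [DecidableEq ι] [DecidableEq κ]
    (h : ι → κ → Bool → ℝ) :
    ∑ f : ι → κ → Bool, ∏ i, ∏ g, h i g (f i g) = ∏ i, ∏ g, (h i g true + h i g false) := by
  have h1 := (Fintype.prod_sum (fun (i : ι) (x : κ → Bool) => ∏ g, h i g (x g))).symm
  rw [h1]
  refine Finset.prod_congr rfl fun i _ => ?_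
  have h2 := (Fintype.prod_sum (fun (g : κ) (x : Bool) => h i g x)).symm
  rw [h2]
  exact Finset.prod_congr rfl fun g _ => by simp

/-- The weight of a Boolean flag table whose entries are independently `true` with
probability `1 - p`. -/
noncomputable def flagWeight {ι κ : Type*} [Fintype ι] [Fintype κ] (p : ℝ)
    (f : ι → κ → Bool) : ℝ :=
  ∏ i, ∏ g, (if f i g then 1 - p else p)

lemma flagWeight_nonneg {ι κ : Type*} [Fintype ι] [Fintype κ] {p : ℝ} (hp0 : 0 ≤ p)
    (hp1 : p ≤ 1) (f : ι → κ → Bool) : 0 ≤ flagWeight p f :=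
  Finset.prod_nonneg fun i _ => Finset.prod_nonneg fun g _ => by split_ifs <;> linarith

lemma sum_flagWeight {ι κ : Type*} [Fintype ι] [Fintype κ] [DecidableEq ι] [DecidableEq κ]
    (p : ℝ) : ∑ f : ι → κ → Bool, flagWeight p f = 1 := by
  unfold flagWeight
  rw [sum_prod_prod_flags (fun _ _ b => if b then 1 - p else p)]
  simp

/-- The probability that all flags in `S` are `true`. -/
lemma sum_flagWeight_mul_prod {ι κ : Type*} [Fintype ι] [Fintype κ] [DecidableEq ι]
    [DecidableEq κ] (p : ℝ) (S : Finset (ι × κ)) :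
    ∑ f : ι → κ → Bool, flagWeight p f * ∏ x ∈ S, (if f x.1 x.2 then (1 : ℝ) else 0) =
      (1 - p) ^ S.card := by
  have h1 : ∀ f : ι → κ → Bool,
      flagWeight p f * ∏ x ∈ S, (if f x.1 x.2 then (1 : ℝ) else 0) =
        ∏ i, ∏ g, (fun i g (b : Bool) => (if b then 1 - p else p) *
          (if (i, g) ∈ S then (if b then (1 : ℝ) else 0) else 1)) i g (f i g) := by
    intro f
    have h2 : ∏ x ∈ S, (if f x.1 x.2 then (1 : ℝ) else 0) =
        ∏ i, ∏ g, (if (i, g) ∈ S then (if f i g then (1 : ℝ) else 0) else 1) := by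
      rw [← Fintype.prod_prod_type'
        (fun i g => if (i, g) ∈ S then (if f i g then (1 : ℝ) else 0) else 1)]
      simp [Finset.prod_ite_mem]
    rw [h2, flagWeight]
    simp only [Finset.prod_mul_distrib]
  simp_rw [h1]
  rw [sum_prod_prod_flags (fun i g (b : Bool) => (if b then 1 - p else p) *
    (if (i, g) ∈ S then (if b then (1 : ℝ) else 0) else 1))]
  have h3 : ∀ (i : ι) (g : κ),
      ((if true = true then 1 - p else p) *
          (if (i, g) ∈ S then (if true = true then (1 : ℝ) else 0) else 1) +
        (if false = true then 1 - p else p) *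
          (if (i, g) ∈ S then (if false = true then (1 : ℝ) else 0) else 1)) =
        if (i, g) ∈ S then 1 - p else 1 := by
    intro i g
    by_cases h : (i, g) ∈ S <;> simp [h]
  refine (Finset.prod_congr rfl fun i _ => Finset.prod_congr rfl fun g _ => h3 i g).trans ?_
  rw [← Fintype.prod_prod_type' (fun i g => if (i, g) ∈ S then 1 - p else 1)]
  simp [Finset.prod_ite_mem]

/-- For pairwise disjoint blocks `B v`, the events that `B v` contains a `false` flag are
independent. -/
lemma sum_flagWeight_mul_prod_one_sub {ι κ V : Type*} [Fintype ι] [Fintype κ] [Fintype V]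
    [DecidableEq ι] [DecidableEq κ] [DecidableEq V] (p : ℝ) (B : V → Finset (ι × κ))
    (hB : Pairwise fun v w => Disjoint (B v) (B w)) :
    ∑ f : ι → κ → Bool,
        flagWeight p f * ∏ v, (1 - ∏ x ∈ B v, (if f x.1 x.2 then (1 : ℝ) else 0)) =
      ∏ v, (1 - (1 - p) ^ (B v).card) := by
  simp_rw [Finset.prod_sub, Finset.prod_const_one, mul_one, Finset.powerset_univ, Finset.mul_sum]
  rw [Finset.sum_comm]
  refine Finset.sum_congr rfl fun W _ => ?_
  have hd : (W : Set V).PairwiseDisjoint B := fun v _ w _ hvw => hB hvw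
  have h1 : ∀ f : ι → κ → Bool,
      flagWeight p f *
        ((-1) ^ W.card * ∏ v ∈ W, ∏ x ∈ B v, (if f x.1 x.2 then (1 : ℝ) else 0)) =
      (-1) ^ W.card *
        (flagWeight p f * ∏ x ∈ W.biUnion B, (if f x.1 x.2 then (1 : ℝ) else 0)) := by
    intro f
    rw [Finset.prod_biUnion hd]
    ring
  simp_rw [h1]
  rw [← Finset.mul_sum, sum_flagWeight_mul_prod, Finset.card_biUnion hd,
    Finset.prod_pow_eq_pow_sum]

/-- The flag index recording the restriction of `c` to `S`. -/
def flagIndex {n d : ℕ} (S : Finset (Fin n)) (c : Fin n → Fin d) : Fin n → Option (Fin d) :=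
  fun v => if v ∈ S then some (c v) else none

lemma flagIndex_congr {n d : ℕ} {S : Finset (Fin n)} {c c' : Fin n → Fin d}
    (h : ∀ v ∈ S, c v = c' v) : flagIndex S c = flagIndex S c' := by
  funext v
  by_cases hv : v ∈ S <;> simp [flagIndex, hv, h]

open scoped Classical in
/-- The probability that no value of `u` satisfies all constraints of `C`, for fixed scopes
containing `u` and a fixed assignment of the other variables. -/
lemma sum_flagWeight_no_extension {n d m : ℕ} (p : ℝ) (s : Fin m → Finset (Fin n)) (u : Fin n)
    (C : Finset (Fin m)) (hC : ∀ j ∈ C, u ∈ s j) (c : Fin n → Fin d) :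
    ∑ f : Fin m → (Fin n → Option (Fin d)) → Bool, flagWeight p f *
        (if ∀ v, ∃ j ∈ C, ¬ f j (flagIndex (s j) (Function.update c u v)) = true
          then (1 : ℝ) else 0) =
      (1 - (1 - p) ^ C.card) ^ d := by
  let B : Fin d → Finset (Fin m × (Fin n → Option (Fin d))) := fun v =>
    C.image fun j => (j, flagIndex (s j) (Function.update c u v))
  have hinj : ∀ v, Function.Injective fun j : Fin m =>
      (j, flagIndex (s j) (Function.update c u v)) := fun v i j hij => (Prod.mk.inj hij).1
  have hcard : ∀ v, (B v).card = C.card := fun v => Finset.card_image_of_injective _ (hinj v)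
  have hB : Pairwise fun v w => Disjoint (B v) (B w) := by
    intro v w hvw
    rw [Finset.disjoint_left]
    intro x hx hx'
    obtain ⟨j, hj, rfl⟩ := Finset.mem_image.1 hx
    obtain ⟨i, hi, hij⟩ := Finset.mem_image.1 hx'
    obtain ⟨rfl, h2⟩ := Prod.mk.inj hij
    have h3 := congrFun h2 u
    simp only [flagIndex, hC _ hj, if_true, Function.update_self, Option.some.injEq] at h3
    exact hvw h3.symm
  have key := sum_flagWeight_mul_prod_one_sub p B hB
  simp only [hcard, Finset.prod_const, Finset.card_univ, Fintype.card_fin] at key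
  rw [← key]
  refine Finset.sum_congr rfl fun f _ => ?_
  congr 1
  have h1 : ∀ v, (1 - ∏ x ∈ B v, (if f x.1 x.2 then (1 : ℝ) else 0)) =
      if ∃ j ∈ C, ¬ f j (flagIndex (s j) (Function.update c u v)) = true then 1 else 0 := by
    intro v
    rw [Finset.prod_image fun i _ j _ h => hinj v h]
    split_ifs with h
    · obtain ⟨j, hj, hf⟩ := h
      rw [Finset.prod_eq_zero hj (by simp [hf])]
      simp
    · push Not at h
      rw [Finset.prod_eq_one fun j hj => by simp [h j hj]]
      simp
  simp_rw [h1]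
  rw [Finset.prod_boole]
  simp

open scoped Classical in
/-- Union bound for a finite nonnegative weight. -/
lemma sum_mul_exists_le {F X : Type*} [Fintype F] (w : F → ℝ) (hw : ∀ f, 0 ≤ w f)
    (I : Finset X) (P : X → F → Prop) [∀ x f, Decidable (P x f)] (b : ℝ)
    (hP : ∀ x ∈ I, ∑ f, w f * (if P x f then (1 : ℝ) else 0) ≤ b) :
    ∑ f, w f * (if ∃ x ∈ I, P x f then (1 : ℝ) else 0) ≤ I.card * b := by
  calc ∑ f, w f * (if ∃ x ∈ I, P x f then (1 : ℝ) else 0)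
      ≤ ∑ f, w f * ∑ x ∈ I, (if P x f then (1 : ℝ) else 0) := by
        refine Finset.sum_le_sum fun f _ => mul_le_mul_of_nonneg_left ?_ (hw f)
        have h0 : ∀ x ∈ I, (0 : ℝ) ≤ if P x f then (1 : ℝ) else 0 := fun x _ => by
          split_ifs <;> norm_num
        split_ifs with h
        · obtain ⟨x, hx, hxf⟩ := h
          have := Finset.single_le_sum h0 hx
          rwa [if_pos hxf] at this
        · exact Finset.sum_nonneg h0
    _ = ∑ x ∈ I, ∑ f, w f * (if P x f then (1 : ℝ) else 0) := by
        simp_rw [Finset.mul_sum]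
        exact Finset.sum_comm
    _ ≤ ∑ _x ∈ I, b := Finset.sum_le_sum hP
    _ = I.card * b := by simp

lemma card_filter_card_le (m T : ℕ) :
    (Finset.univ.filter fun C : Finset (Fin m) => C.card ≤ T).card ≤ (m + 1) ^ T := by
  have h : (Finset.univ.filter fun C : Finset (Fin m) => C.card ≤ T) =
      (Finset.range (T + 1)).biUnion fun i => Finset.powersetCard i Finset.univ := by
    ext C
    simp [Finset.mem_powersetCard]
  rw [h, add_pow]
  refine Finset.card_biUnion_le.trans (Finset.sum_le_sum fun i hi => ?_)
  rw [Finset.card_powersetCard, Finset.card_univ, Fintype.card_fin]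
  simp only [one_pow, mul_one]
  refine (Nat.choose_le_pow m i).trans (Nat.le_mul_of_pos_right _ (Nat.choose_pos ?_))
  exact Nat.lt_succ_iff.1 (Finset.mem_range.1 hi)

open scoped Classical in
/-- For fixed scopes of size `k`, bound on the probability that some variable `u`, some set `C`
of at most `T` constraints containing `u` and some assignment of the other variables admit no
compatible value for `u`. -/
lemma sum_flagWeight_exists_no_extension_le {n d m k T : ℕ} {p : ℝ} (hp0 : 0 ≤ p) (hp1 : p ≤ 1)
    (hd : 0 < d) (s : Fin m → Finset (Fin n)) (hs : ∀ j, (s j).card = k) (b : ℝ) (hb : 0 ≤ b)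
    (hbT : ∀ i ≤ T, (1 - (1 - p) ^ i) ^ d ≤ b) :
    ∑ f : Fin m → (Fin n → Option (Fin d)) → Bool, flagWeight p f *
        (if ∃ u, ∃ C : Finset (Fin m), (∀ j ∈ C, u ∈ s j) ∧ C.card ≤ T ∧ ∃ c : Fin n → Fin d,
          ∀ v, ∃ j ∈ C, ¬ f j (flagIndex (s j) (Function.update c u v)) = true
          then (1 : ℝ) else 0) ≤
      (n * (m + 1) ^ T * d ^ (k * T) : ℕ) * b := by
  let 𝒞 : Finset (Finset (Fin m)) := Finset.univ.filter fun C => C.card ≤ T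
  let D : Finset (Fin m) → Finset (Fin n → Fin d) := fun C =>
    Fintype.piFinset fun v => if v ∈ C.biUnion s then Finset.univ else {⟨0, hd⟩}
  let I : Finset (Fin n × (Σ _ : Finset (Fin m), Fin n → Fin d)) :=
    Finset.univ ×ˢ 𝒞.sigma D
  have hD : ∀ C ∈ 𝒞, (D C).card ≤ d ^ (k * T) := by
    intro C hC
    have hC' : C.card ≤ T := (Finset.mem_filter.1 hC).2
    have h1 : (D C).card = d ^ (C.biUnion s).card := by
      simp only [D, Fintype.card_piFinset]
      have h2 : ∀ v, (if v ∈ C.biUnion s then Finset.univ else {(⟨0, hd⟩ : Fin d)}).card =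
          if v ∈ C.biUnion s then d else 1 := fun v => by split_ifs <;> simp
      simp_rw [h2]
      rw [Finset.prod_ite_mem]
      simp
    rw [h1]
    refine Nat.pow_le_pow_right hd ?_
    calc (C.biUnion s).card ≤ C.card * k := Finset.card_biUnion_le_card_mul _ _ _ fun j _ => (hs j).le
      _ ≤ k * T := by rw [mul_comm]; exact Nat.mul_le_mul_left _ hC'
  have hI : I.card ≤ n * (m + 1) ^ T * d ^ (k * T) := by
    rw [Finset.card_product, Finset.card_univ, Fintype.card_fin, Finset.card_sigma, mul_assoc]
    refine Nat.mul_le_mul_left _ ((Finset.sum_le_card_nsmul _ _ _ hD).trans ?_)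
    rw [smul_eq_mul]
    exact Nat.mul_le_mul_right _ (card_filter_card_le m T)
  let P : Fin n × (Σ _ : Finset (Fin m), Fin n → Fin d) →
      (Fin m → (Fin n → Option (Fin d)) → Bool) → Prop := fun x f =>
    (∀ j ∈ x.2.1, x.1 ∈ s j) ∧
      ∀ v, ∃ j ∈ x.2.1, ¬ f j (flagIndex (s j) (Function.update x.2.2 x.1 v)) = true
  have hP : ∀ x ∈ I, ∑ f, flagWeight p f * (if P x f then (1 : ℝ) else 0) ≤ b := by
    rintro ⟨u, C, c⟩ hx
    have hC : C.card ≤ T := by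
      simp only [I, 𝒞, Finset.mem_product, Finset.mem_sigma, Finset.mem_filter] at hx
      exact hx.2.1.2
    by_cases hu : ∀ j ∈ C, u ∈ s j
    · have h1 := sum_flagWeight_no_extension p s u C hu c
      refine le_trans (le_of_eq ?_) (hbT _ hC)
      rw [← h1]
      refine Finset.sum_congr rfl fun f _ => ?_
      congr 1
      exact if_congr (and_iff_right hu) rfl rfl
    · have h2 : ∀ f, ¬ P (u, ⟨C, c⟩) f := fun f h => hu h.1
      simpa [h2] using hb
  refine le_trans ?_ ((sum_mul_exists_le _ (flagWeight_nonneg hp0 hp1) I P b hP).trans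
    (mul_le_mul_of_nonneg_right (Nat.cast_le.2 hI) hb))
  refine Finset.sum_le_sum fun f _ =>
    mul_le_mul_of_nonneg_left ?_ (flagWeight_nonneg hp0 hp1 f)
  have himp : (∃ u, ∃ C : Finset (Fin m), (∀ j ∈ C, u ∈ s j) ∧ C.card ≤ T ∧
      ∃ c : Fin n → Fin d, ∀ v, ∃ j ∈ C,
        ¬ f j (flagIndex (s j) (Function.update c u v)) = true) → ∃ x ∈ I, P x f := by
    rintro ⟨u, C, hu, hC, c, hc⟩
    let c' : Fin n → Fin d := fun v => if v ∈ C.biUnion s then c v else ⟨0, hd⟩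
    refine ⟨(u, ⟨C, c'⟩), ?_, hu, fun v => ?_⟩
    · simp only [I, 𝒞, D, c', Finset.mem_product, Finset.mem_univ, true_and, Finset.mem_sigma,
        Finset.mem_filter, hC, Fintype.mem_piFinset]
      intro v
      split_ifs <;> simp
    · obtain ⟨j, hj, hf⟩ := hc v
      refine ⟨j, hj, ?_⟩
      have : flagIndex (s j) (Function.update c' u v) =
          flagIndex (s j) (Function.update c u v) := by
        refine flagIndex_congr fun w hw => ?_
        have hw' : w ∈ C.biUnion s := Finset.mem_biUnion.2 ⟨j, hj, hw⟩
        simp only [Function.update_apply, c', if_pos hw']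
      rw [this]
      exact hf
  split_ifs with h1 h2
  · exact le_rfl
  · exact absurd (himp h1) h2
  · norm_num
  · exact le_rfl

/-- An event holding with probability at least `a` for every choice of scopes holds with
probability at least `a`. -/
lemma le_rdPr_of_forall_scopes {n d m k : ℕ} (p a : ℝ) (hk : k ≤ n)
    (E : RDOmega n d m k → Prop) [DecidablePred E]
    (h : ∀ s, a ≤ ∑ f, flagWeight p f * (if E (s, f) then (1 : ℝ) else 0)) :
    a ≤ rdPr p n d m k E := by
  have hN : (0 : ℝ) < Fintype.card {S : Finset (Fin n) // S.card = k} := by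
    rw [Fintype.card_finset_len, Fintype.card_fin]
    exact_mod_cast Nat.choose_pos hk
  set N : ℝ := ((Fintype.card {S : Finset (Fin n) // S.card = k} : ℕ) : ℝ) with hNdef
  have h1 : rdPr p n d m k E =
      ∑ s, N⁻¹ ^ m * ∑ f, flagWeight p f * (if E (s, f) then (1 : ℝ) else 0) := by
    unfold rdPr
    rw [Finset.sum_filter, Fintype.sum_prod_type]
    refine Finset.sum_congr rfl fun s _ => ?_
    rw [Finset.mul_sum]
    refine Finset.sum_congr rfl fun f _ => ?_
    by_cases hE : E (s, f)
    · simp only [hE, if_true, mul_one]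
      rfl
    · simp [hE]
  rw [h1]
  calc a = ∑ _s : Fin m → {S : Finset (Fin n) // S.card = k}, N⁻¹ ^ m * a := by
        rw [Finset.sum_const, Finset.card_univ, Fintype.card_fun, Fintype.card_fin, nsmul_eq_mul,
          Nat.cast_pow, ← hNdef, ← mul_assoc, ← mul_pow, mul_inv_cancel₀ hN.ne', one_pow, one_mul]
    _ ≤ _ := Finset.sum_le_sum fun s _ =>
        mul_le_mul_of_nonneg_left (h s) (pow_nonneg (inv_nonneg.2 hN.le) m)

/-- Nonasymptotic form of the consistency bound. -/
lemma le_rdPr_consistent {n d m k : ℕ} {p t b : ℝ} (hp0 : 0 ≤ p) (hp1 : p ≤ 1)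
    (hkn : k ≤ n) (hd : 0 < d) (hb : 0 ≤ b)
    (hbT : ∀ i ≤ ⌊t⌋₊, (1 - (1 - p) ^ i) ^ d ≤ b) :
    1 - (n * (m + 1) ^ ⌊t⌋₊ * d ^ (k * ⌊t⌋₊) : ℕ) * b ≤ rdPr p n d m k
      (fun ω => ∀ u : Fin n, ∀ Cu : Finset (Fin m), (∀ j ∈ Cu, u ∈ (ω.1 j).1) →
        ((Cu.card : ℝ) ≤ t) → ∀ c : Fin n → Fin d,
          (∀ j, (ω.1 j).1 ⊆ (Cu.biUnion (fun j' => (ω.1 j').1)).erase u → rdCompat ω j c) →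
          ∃ v, ∀ j ∈ Cu, rdCompat ω j (Function.update c u v)) := by
  classical
  refine le_rdPr_of_forall_scopes p _ hkn _ fun s => ?_
  have h1 := sum_flagWeight_exists_no_extension_le (T := ⌊t⌋₊) hp0 hp1 hd
    (fun j => (s j).1) (fun j => (s j).2) b hb hbT
  have h2 := sum_flagWeight (ι := Fin m) (κ := Fin n → Option (Fin d)) p
  refine le_trans (sub_le_sub_left h1 1) ?_
  rw [sub_le_iff_le_add, ← Finset.sum_add_distrib]
  refine h2.symm.le.trans (Finset.sum_le_sum fun f _ => ?_)
  have hw := flagWeight_nonneg hp0 hp1 f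
  by_cases hbad : ∃ u, ∃ C : Finset (Fin m), (∀ j ∈ C, u ∈ (s j).1) ∧ C.card ≤ ⌊t⌋₊ ∧
      ∃ c : Fin n → Fin d, ∀ v, ∃ j ∈ C,
        ¬ f j (flagIndex (s j).1 (Function.update c u v)) = true
  · rw [if_pos hbad, mul_one]
    exact le_add_of_nonneg_left (mul_nonneg hw (by split_ifs <;> norm_num))
  · rw [if_neg hbad, mul_zero, add_zero, if_pos, mul_one]
    intro u C hC hCt c _
    by_contra hno
    push Not at hno
    exact hbad ⟨u, C, hC, Nat.le_floor hCt, c, hno⟩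

lemma eventually_log_bound (C δ : ℝ) (hδ : 0 < δ) :
    ∀ᶠ L : ℝ in Filter.atTop,
      L + C * L ^ 2 + Real.exp (δ / 2 * L) ≤ Real.exp (δ * L) := by
  have h1 : (fun L : ℝ => L ^ 1) =o[Filter.atTop] fun L => Real.exp (δ * L) :=
    isLittleO_pow_exp_pos_mul_atTop 1 hδ
  have h2 : (fun L : ℝ => L ^ 2) =o[Filter.atTop] fun L => Real.exp (δ * L) :=
    isLittleO_pow_exp_pos_mul_atTop 2 hδ
  have h3 : (fun L : ℝ => Real.exp (δ / 2 * L)) =o[Filter.atTop] fun L => Real.exp (δ * L) := by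
    rw [Real.isLittleO_exp_comp_exp_comp]
    have : (fun L : ℝ => δ * L - δ / 2 * L) = fun L => δ / 2 * L := by funext L; ring
    rw [this]
    exact Filter.tendsto_id.const_mul_atTop (half_pos hδ)
  have h4 := ((h1.add (h2.const_mul_left C)).add h3).bound (c := 1) one_pos
  filter_upwards [h4] with L hL
  simp only [pow_one, one_mul, Real.norm_eq_abs, Real.abs_exp] at hL
  exact (le_abs_self _).trans hL

/-- Let `α > 0`, `p ∈ (0,1)`, `k ≥ 2`, `r_bf = -α/(k ln(1-p))`, `r < r_bf` and
`0 < ε < min((r_bf - r)/r, 1/2)`, and set `t = (1+ε) k r ln n`. Then there is `γ > 0`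
such that for all sufficiently large `n`, a random instance of Model RD (with domain size
`d = ⌈n^α⌉` and `m = ⌈r n ln n⌉` constraints) is vertex-centered `t`-consistent with
probability at least `1 - exp(-n^γ)`. -/
theorem rd_vcConsistent_whp (α p r ε : ℝ) (k : ℕ) (hα : 0 < α) (hp0 : 0 < p) (hp1 : p < 1)
    (hk : 2 ≤ k) (hr0 : 0 < r) (hr : r < -α / (k * Real.log (1 - p)))
    (hε0 : 0 < ε) (hε : ε < min ((-α / (k * Real.log (1 - p)) - r) / r) (1 / 2)) :
    ∃ γ > (0 : ℝ), ∀ᶠ n : ℕ in Filter.atTop,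
      rdPr p n ⌈(n : ℝ) ^ α⌉₊ ⌈r * n * Real.log n⌉₊ k
        (fun ω => ∀ u : Fin n, ∀ Cu : Finset (Fin ⌈r * n * Real.log n⌉₊),
          (∀ j ∈ Cu, u ∈ (ω.1 j).1) →
          ((Cu.card : ℝ) ≤ (1 + ε) * k * r * Real.log n) →
          ∀ c : Fin n → Fin ⌈(n : ℝ) ^ α⌉₊,
            (∀ j, (ω.1 j).1 ⊆ (Cu.biUnion (fun j' => (ω.1 j').1)).erase u →
              rdCompat ω j c) →
            ∃ v, ∀ j ∈ Cu, rdCompat ω j (Function.update c u v))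
      ≥ 1 - Real.exp (-(n : ℝ) ^ γ) := by
  have hl : Real.log (1 - p) < 0 := Real.log_neg (by linarith) (by linarith)
  have hk0 : (0 : ℝ) < k := by exact_mod_cast (by omega : 0 < k)
  set l := Real.log (1 - p) with hl_def
  set τ : ℝ := (1 + ε) * k * r with hτ_def
  have hτ : 0 < τ := by positivity
  have hδ : 0 < α + τ * l := by
    have h1 : ε < (-α / (k * l) - r) / r := lt_of_lt_of_le hε (min_le_left _ _)
    rw [lt_div_iff₀ hr0] at h1
    have h2 : (1 + ε) * r < -α / (k * l) := by linarith
    rw [lt_div_iff_of_neg (mul_neg_of_pos_of_neg hk0 hl)] at h2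
    rw [hτ_def]
    linarith
  set δ := α + τ * l with hδ_def
  refine ⟨δ / 2, half_pos hδ, ?_⟩
  have hlog : Filter.Tendsto (fun n : ℕ => Real.log n) Filter.atTop Filter.atTop :=
    Real.tendsto_log_atTop.comp tendsto_natCast_atTop_atTop
  have hpoly : ∀ᶠ L : ℝ in Filter.atTop, r * L + 2 ≤ Real.exp L := by
    have h1 : (fun L : ℝ => L ^ 1) =o[Filter.atTop] fun L => Real.exp (1 * L) :=
      isLittleO_pow_exp_pos_mul_atTop 1 one_pos
    have h2 : (fun _ : ℝ => (2 : ℝ)) =o[Filter.atTop] fun L => Real.exp (1 * L) := by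
      simpa using (isLittleO_pow_exp_pos_mul_atTop 0 one_pos).const_mul_left (2 : ℝ)
    filter_upwards [((h1.const_mul_left r).add h2).bound (c := 1) one_pos] with L hL
    simp only [pow_one, one_mul, Real.norm_eq_abs, Real.abs_exp] at hL
    exact (le_abs_self _).trans hL
  filter_upwards [hlog.eventually (eventually_log_bound (2 * τ + (α + 1) * (k * τ)) δ hδ),
    hlog.eventually hpoly, hlog.eventually (Filter.eventually_ge_atTop 1),
    Filter.eventually_ge_atTop (max k 1)] with n hmain hm hL hn
  have hn0 : (0 : ℝ) < n := by exact_mod_cast (le_max_right k 1).trans hn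
  set L := Real.log n with hL_def
  have hnL : Real.exp L = n := Real.exp_log hn0
  have hpow : ∀ x : ℝ, (n : ℝ) ^ x = Real.exp (x * L) := fun x => by
    rw [Real.rpow_def_of_pos hn0, mul_comm]
  set d := ⌈(n : ℝ) ^ α⌉₊ with hd_def
  set m := ⌈r * n * L⌉₊ with hm_def
  have hd : 0 < d := Nat.ceil_pos.2 (Real.rpow_pos_of_pos hn0 α)
  have hd1 : Real.exp (α * L) ≤ d := by
    rw [← hpow]
    exact Nat.le_ceil _
  have hd2 : (d : ℝ) ≤ Real.exp ((α + 1) * L) := by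
    have h1 : (d : ℝ) < n ^ α + 1 := Nat.ceil_lt_add_one (Real.rpow_nonneg hn0.le α)
    rw [hpow] at h1
    have h2 : 1 ≤ Real.exp (α * L) := Real.one_le_exp (by positivity)
    have h3 : 2 ≤ Real.exp L := by linarith [Real.add_one_le_exp L]
    rw [add_mul, one_mul, Real.exp_add]
    nlinarith
  have hm2 : (m : ℝ) + 1 ≤ Real.exp (2 * L) := by
    have h1 : (m : ℝ) < r * n * L + 1 := Nat.ceil_lt_add_one (by positivity)
    have h2 : 1 ≤ Real.exp L := Real.one_le_exp (by linarith)
    rw [two_mul, Real.exp_add]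
    rw [← hnL] at h1
    nlinarith
  set t : ℝ := τ * L with ht_def
  have ht : 0 ≤ t := by positivity
  have hT : (⌊t⌋₊ : ℝ) ≤ t := Nat.floor_le ht
  have hbT : ∀ i ≤ ⌊t⌋₊, (1 - (1 - p) ^ i) ^ d ≤ Real.exp (-Real.exp (δ * L)) := by
    intro i hi
    have hit : (i : ℝ) ≤ t := (Nat.cast_le.2 hi).trans hT
    have h1 : (1 - p) ^ i = Real.exp (i * l) := by
      rw [Real.exp_nat_mul, hl_def, Real.exp_log (by linarith)]
    have h2 : Real.exp (t * l) ≤ (1 - p) ^ i := by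
      rw [h1]
      exact Real.exp_le_exp.2 (mul_le_mul_of_nonpos_right hit hl.le)
    have h3 : (1 - p) ^ i ≤ 1 := pow_le_one₀ (by linarith) (by linarith)
    calc (1 - (1 - p) ^ i) ^ d ≤ Real.exp (-Real.exp (t * l)) ^ d := by
          refine pow_le_pow_left₀ (by linarith) ?_ d
          linarith [Real.add_one_le_exp (-Real.exp (t * l))]
      _ = Real.exp (-(d * Real.exp (t * l))) := by
          rw [← Real.exp_nat_mul]
          congr 1
          ring
      _ ≤ _ := by
          refine Real.exp_le_exp.2 (neg_le_neg ?_)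
          have h4 : Real.exp (δ * L) = Real.exp (α * L) * Real.exp (t * l) := by
            rw [← Real.exp_add, hδ_def, ht_def]
            congr 1
            ring
          rw [h4]
          exact mul_le_mul_of_nonneg_right hd1 (Real.exp_pos _).le
  refine ge_iff_le.2 (le_trans (sub_le_sub_left ?_ 1) (le_rdPr_consistent hp0.le hp1.le
    ((le_max_left k 1).trans hn) hd (Real.exp_pos _).le hbT))
  push_cast
  rw [hpow]
  have e1 : ((m : ℝ) + 1) ^ ⌊t⌋₊ ≤ Real.exp (t * (2 * L)) := by
    refine (pow_le_pow_left₀ (by positivity) hm2 _).trans ?_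
    rw [← Real.exp_nat_mul]
    exact Real.exp_le_exp.2 (mul_le_mul_of_nonneg_right hT (by linarith))
  have e2 : (d : ℝ) ^ (k * ⌊t⌋₊) ≤ Real.exp (k * t * ((α + 1) * L)) := by
    refine (pow_le_pow_left₀ (by positivity) hd2 _).trans ?_
    rw [← Real.exp_nat_mul]
    refine Real.exp_le_exp.2 (mul_le_mul_of_nonneg_right ?_ (by positivity))
    push_cast
    exact mul_le_mul_of_nonneg_left hT hk0.le
  calc (n : ℝ) * (m + 1) ^ ⌊t⌋₊ * d ^ (k * ⌊t⌋₊) * Real.exp (-Real.exp (δ * L))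
      ≤ Real.exp L * Real.exp (t * (2 * L)) * Real.exp (k * t * ((α + 1) * L)) *
          Real.exp (-Real.exp (δ * L)) := by
        rw [hnL]
        gcongr
    _ = Real.exp (L + t * (2 * L) + k * t * ((α + 1) * L) + -Real.exp (δ * L)) := by
        simp only [Real.exp_add]
    _ ≤ Real.exp (-Real.exp (δ / 2 * L)) := by
        refine Real.exp_le_exp.2 ?_
        rw [ht_def]
        linarith
end
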